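/- There exists z ∈ ℝ^m with ‖z‖ = 1 and zᵀ Q_i z = 0 for all i = 1,…,r if and only if there exists z ∈ ℝ^m with ‖z‖ = 1 and |p(z)| ≥ B, where p(z) = B·‖z‖⁴ − Σ_{i=1}^r (zᵀ Q_i z)² and B = 1 + Σ_{i=1}^r ‖Q_i‖_F². -/

import Mathlib

/-- Feasibility of the homogeneous quadratic system on the sphere is
equivalent to the tensor spectral threshold instance: there is a unit `z` with
`zᵀQᵢz = 0` for all `i` iff there is a unit `z` with `|p(z)| ≥ B`, where
`p(z) = B‖z‖⁴ − Σᵢ (zᵀQᵢz)²` and `B = 1 + Σᵢ ‖Qᵢ‖_F²`. -/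
theorem feasibility_iff_threshold (m r : ℕ) (hm : 0 < m) (hr : 0 < r)
    (Q : Fin r → Matrix (Fin m) (Fin m) ℝ) (hQ : ∀ i, (Q i).IsSymm)
    (B : ℝ) (hB : B = 1 + ∑ i, Real.sqrt (∑ a, ∑ b, (Q i a b) ^ 2) ^ 2) :
    (∃ z : EuclideanSpace ℝ (Fin m), ‖z‖ = 1 ∧
        ∀ i, ∑ a, ∑ b, z a * Q i a b * z b = 0) ↔
    (∃ z : EuclideanSpace ℝ (Fin m), ‖z‖ = 1 ∧
        B ≤ |B * ‖z‖ ^ 4 - ∑ i, (∑ a, ∑ b, z a * Q i a b * z b) ^ 2|) := by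
  have key : ∀ z : EuclideanSpace ℝ (Fin m), ‖z‖ = 1 → ∀ i,
      (∑ a, ∑ b, z a * Q i a b * z b) ^ 2 ≤ Real.sqrt (∑ a, ∑ b, (Q i a b) ^ 2) ^ 2 := by
    intro z hz i
    have hz2 : ∑ a, z a ^ 2 = 1 := by
      rw [← EuclideanSpace.real_norm_sq_eq, hz, one_pow]
    have hn : (0 : ℝ) ≤ ∑ a, ∑ b, (Q i a b) ^ 2 :=
      Finset.sum_nonneg fun a _ => Finset.sum_nonneg fun b _ => sq_nonneg _
    rw [Real.sq_sqrt hn]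
    have h := Finset.sum_mul_sq_le_sq_mul_sq (Finset.univ : Finset (Fin m × Fin m))
      (fun x => Q i x.1 x.2) (fun x => z x.1 * z x.2)
    simp only [Fintype.sum_prod_type] at h
    have h1 : ∑ a, ∑ b, (z a * z b) ^ 2 = 1 := by
      simp only [mul_pow]
      rw [← Finset.sum_mul_sum, hz2, one_mul]
    rw [h1, mul_one] at h
    refine le_trans (le_of_eq ?_) h
    congr 1
    refine Finset.sum_congr rfl fun a _ => Finset.sum_congr rfl fun b _ => ?_
    ring
  constructor
  · rintro ⟨z, hz, h⟩
    refine ⟨z, hz, ?_⟩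
    simp only [hz, h]
    simpa using le_abs_self B
  · rintro ⟨z, hz, h⟩
    refine ⟨z, hz, ?_⟩
    have hS := Finset.sum_le_sum fun i (_ : i ∈ Finset.univ) => key z hz i
    rw [hz, one_pow, mul_one, abs_of_nonneg (by linarith)] at h
    have h0 : ∑ i, (∑ a, ∑ b, z a * Q i a b * z b) ^ 2 = 0 :=
      le_antisymm (by linarith) (Finset.sum_nonneg fun i _ => sq_nonneg _)
    intro i
    have := (Finset.sum_eq_zero_iff_of_nonneg fun i _ => sq_nonneg _).1 h0 i (Finset.mem_univ i)
    exact pow_eq_zero_iff two_ne_zero |>.1 this
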